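/- arXiv:2001.08207 — 5 statements merged into one kernel-verified Lean document; each statement's English description precedes it below -/
import Mathlib

section
/- Fix an integer n ≥ 3, let τ > 0 with t_m = mτ, and let g : [0, t_n] → ℝ be integrable, nonnegative, and nonincreasing. Let c_0^k(s) = (τ + s − t_k)(2τ + s − t_k)/(2τ²), c_1^k(s) = (t_k − s)(2τ + s − t_k)/τ², c_2^k(s) = (s − t_k)(τ + s − t_k)/(2τ²) be the order-3 Lagrange coefficients. Then for every integer k with 1 ≤ k and k + 2 ≤ n, the combined weight w̃_k^3 = ∫_{t_{k−1}}^{t_k} c_0^k(s) g(s) ds + ∫_{t_k}^{t_{k+1}} c_1^{k+1}(s) g(s) ds + ∫_{t_{k+1}}^{t_{k+2}} c_2^{k+2}(s) g(s) ds satisfies w̃_k^3 ≥ τ · g(t_{k+1}) ≥ 0. -/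
open Finset MeasureTheory

/-- A continuous weight against `g`, when `c * G ≤ c * g` pointwise. -/
theorem integral_weight_mul_le {a b G : ℝ} {c g : ℝ → ℝ} (hab : a ≤ b) (hc : Continuous c)
    (hg : IntervalIntegrable g volume a b) (h : ∀ s ∈ Set.Icc a b, c s * G ≤ c s * g s) :
    (∫ s in a..b, c s) * G ≤ ∫ s in a..b, c s * g s := by
  rw [← intervalIntegral.integral_mul_const]
  exact intervalIntegral.integral_mono_on hab ((hc.mul continuous_const).intervalIntegrable _ _)
    (hg.continuousOn_mul hc.continuousOn) h

/-- The integral of a quadratic polynomial centred at the left endpoint. -/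
theorem integral_quadratic_sub (a b p q r : ℝ) :
    ∫ s in a..b, (p + q * (s - a) + r * (s - a) ^ 2) =
      p * (b - a) + q * (b - a) ^ 2 / 2 + r * (b - a) ^ 3 / 3 := by
  rw [intervalIntegral.integral_eq_sub_of_hasDerivAt
    (f := fun s ↦ p * (s - a) + q * (s - a) ^ 2 / 2 + r * (s - a) ^ 3 / 3)]
  · ring
  · intro s _
    have h : HasDerivAt (fun s : ℝ ↦ s - a) 1 s := (hasDerivAt_id s).sub_const a
    refine (((h.const_mul p).add (((h.pow 2).const_mul q).div_const 2)).add
      (((h.pow 3).const_mul r).div_const 3)).congr_deriv ?_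
    norm_num
    ring
  · exact (by fun_prop : Continuous fun s ↦ p + q * (s - a) + r * (s - a) ^ 2).intervalIntegrable _ _

/-- **stability of the order-3 scheme.** On the uniform mesh `t_m = mτ`,
for a nonnegative nonincreasing integrable `g` on `[0, t_n]` and `1 ≤ k`, `k + 2 ≤ n`,
the combined weight
`w̃_k^3 = ∫_{t_{k-1}}^{t_k} c_0^k g + ∫_{t_k}^{t_{k+1}} c_1^{k+1} g + ∫_{t_{k+1}}^{t_{k+2}} c_2^{k+2} g`
(with the explicit order-3 Lagrange coefficients) satisfies `w̃_k^3 ≥ τ · g(t_{k+1}) ≥ 0`. -/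
theorem stmt7 (n : ℕ) (hn : 3 ≤ n) (τ : ℝ) (hτ : 0 < τ)
    (g : ℝ → ℝ) (hg : IntegrableOn g (Set.Icc 0 ((n : ℝ) * τ)))
    (hg0 : ∀ s ∈ Set.Icc (0 : ℝ) ((n : ℝ) * τ), 0 ≤ g s)
    (hgmono : AntitoneOn g (Set.Icc (0 : ℝ) ((n : ℝ) * τ)))
    (k : ℕ) (hk1 : 1 ≤ k) (hk2 : k + 2 ≤ n) :
    0 ≤ τ * g (((k : ℝ) + 1) * τ) ∧
    τ * g (((k : ℝ) + 1) * τ) ≤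
      (∫ s in (((k : ℝ) - 1) * τ)..((k : ℝ) * τ),
          ((τ + s - (k : ℝ) * τ) * (2 * τ + s - (k : ℝ) * τ) / (2 * τ ^ 2)) * g s)
      + (∫ s in ((k : ℝ) * τ)..(((k : ℝ) + 1) * τ),
          ((((k : ℝ) + 1) * τ - s) * (2 * τ + s - ((k : ℝ) + 1) * τ) / τ ^ 2) * g s)
      + (∫ s in (((k : ℝ) + 1) * τ)..(((k : ℝ) + 2) * τ),
          ((s - ((k : ℝ) + 2) * τ) * (τ + s - ((k : ℝ) + 2) * τ) / (2 * τ ^ 2)) * g s) := by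
  have hk1' : (1 : ℝ) ≤ k := by exact_mod_cast hk1
  have hk2' : (k : ℝ) + 2 ≤ n := by exact_mod_cast hk2
  have mesh_nonneg : 0 ≤ ((k : ℝ) - 1) * τ := mul_nonneg (by linarith) hτ.le
  have mesh_le : ((k : ℝ) + 2) * τ ≤ n * τ := mul_le_mul_of_nonneg_right hk2' hτ.le
  have hmem : ((k : ℝ) + 1) * τ ∈ Set.Icc (0 : ℝ) (n * τ) := ⟨by linarith, by linarith⟩
  have hint : ∀ a b : ℝ, 0 ≤ a → a ≤ b → b ≤ n * τ → IntervalIntegrable g volume a b :=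
    fun a b ha hab hb ↦ (intervalIntegrable_iff_integrableOn_Icc_of_le hab).2
      (hg.mono_set (Set.Icc_subset_Icc ha hb))
  refine ⟨mul_nonneg hτ.le (hg0 _ hmem), ?_⟩
  set G := g (((k : ℝ) + 1) * τ)
  have hlarge : ∀ s, 0 ≤ s → s ≤ ((k : ℝ) + 1) * τ → G ≤ g s := fun s h0 h1 ↦
    hgmono ⟨h0, h1.trans hmem.2⟩ hmem h1
  have hsmall : ∀ s, ((k : ℝ) + 1) * τ ≤ s → s ≤ ((k : ℝ) + 2) * τ → g s ≤ G := fun s h0 h1 ↦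
    hgmono hmem ⟨hmem.1.trans h0, h1.trans mesh_le⟩ h0
  have h₀ := integral_weight_mul_le (G := G) (g := g) (a := ((k : ℝ) - 1) * τ) (b := k * τ)
    (c := fun s ↦ (τ + s - (k : ℝ) * τ) * (2 * τ + s - (k : ℝ) * τ) / (2 * τ ^ 2))
    (by linarith) (by fun_prop) (hint _ _ (by linarith) (by linarith) (by linarith))
    (fun s hs ↦ mul_le_mul_of_nonneg_left (hlarge s (by linarith [hs.1]) (by linarith [hs.2]))
      (div_nonneg (mul_nonneg (by linarith [hs.1]) (by linarith [hs.1])) (by positivity)))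
  have h₁ := integral_weight_mul_le (G := G) (g := g) (a := (k : ℝ) * τ) (b := ((k : ℝ) + 1) * τ)
    (c := fun s ↦ (((k : ℝ) + 1) * τ - s) * (2 * τ + s - ((k : ℝ) + 1) * τ) / τ ^ 2)
    (by linarith) (by fun_prop) (hint _ _ (by linarith) (by linarith) (by linarith))
    (fun s hs ↦ mul_le_mul_of_nonneg_left (hlarge s (by linarith [hs.1]) (by linarith [hs.2]))
      (div_nonneg (mul_nonneg (by linarith [hs.2]) (by linarith [hs.1])) (by positivity)))
  have h₂ := integral_weight_mul_le (G := G) (g := g) (a := ((k : ℝ) + 1) * τ)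
    (b := ((k : ℝ) + 2) * τ)
    (c := fun s ↦ (s - ((k : ℝ) + 2) * τ) * (τ + s - ((k : ℝ) + 2) * τ) / (2 * τ ^ 2))
    (by linarith) (by fun_prop) (hint _ _ (by linarith) (by linarith) (by linarith))
    (fun s hs ↦ mul_le_mul_of_nonpos_left (hsmall s hs.1 hs.2)
      (div_nonpos_of_nonpos_of_nonneg
        (mul_nonpos_of_nonpos_of_nonneg (by linarith [hs.2]) (by linarith [hs.1]))
        (by positivity)))
  have e₀ : ∫ s in (((k : ℝ) - 1) * τ)..(k * τ),
      (τ + s - (k : ℝ) * τ) * (2 * τ + s - (k : ℝ) * τ) / (2 * τ ^ 2) = 5 / 12 * τ := by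
    trans ∫ s in (((k : ℝ) - 1) * τ)..(k * τ), (0 + 1 / (2 * τ) * (s - ((k : ℝ) - 1) * τ) +
        1 / (2 * τ ^ 2) * (s - ((k : ℝ) - 1) * τ) ^ 2)
    · congr 1 with s
      field_simp
      ring
    · rw [integral_quadratic_sub]
      field_simp
      ring
  have e₁ : ∫ s in ((k : ℝ) * τ)..(((k : ℝ) + 1) * τ),
      (((k : ℝ) + 1) * τ - s) * (2 * τ + s - ((k : ℝ) + 1) * τ) / τ ^ 2 = 2 / 3 * τ := by
    trans ∫ s in ((k : ℝ) * τ)..(((k : ℝ) + 1) * τ), (1 + 0 * (s - (k : ℝ) * τ) +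
        -1 / τ ^ 2 * (s - (k : ℝ) * τ) ^ 2)
    · congr 1 with s
      field_simp
      ring
    · rw [integral_quadratic_sub]
      field_simp
      ring
  have e₂ : ∫ s in (((k : ℝ) + 1) * τ)..(((k : ℝ) + 2) * τ),
      (s - ((k : ℝ) + 2) * τ) * (τ + s - ((k : ℝ) + 2) * τ) / (2 * τ ^ 2) = -1 / 12 * τ := by
    trans ∫ s in (((k : ℝ) + 1) * τ)..(((k : ℝ) + 2) * τ),
      (0 + -1 / (2 * τ) * (s - ((k : ℝ) + 1) * τ) +
        1 / (2 * τ ^ 2) * (s - ((k : ℝ) + 1) * τ) ^ 2)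
    · congr 1 with s
      field_simp
      ring
    · rw [integral_quadratic_sub]
      field_simp
      ring
  rw [e₀] at h₀
  rw [e₁] at h₁
  rw [e₂] at h₂
  linarith
end

section
/- Fix an integer n ≥ 4, let τ > 0 with t_m = mτ, and let g : [0, t_n] → ℝ be integrable, nonnegative, and nonincreasing. Let c_j^k(s) = ∏_{m=0, m≠j}^{3} (s − t_k + mτ)/((m − j)τ), j = 0,1,2,3, be the order-4 Lagrange coefficients. Then for every integer k with 1 ≤ k and k + 3 ≤ n, the combined weight w̃_k^4 = Σ_{j=0}^{3} ∫_{t_{k+j−1}}^{t_{k+j}} c_j^{k+j}(s) g(s) ds is nonnegative. -/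
open Finset MeasureTheory

/-- The order-`γ` Lagrange coefficient `c_j^k(s)` at the node `t_k`, on a uniform
mesh of step `τ`: `c_j^k(s) = ∏_{m=0, m≠j}^{γ-1} (s - t_k + mτ)/((m - j)τ)`. -/
noncomputable def lagC (γ j : ℕ) (tk τ s : ℝ) : ℝ :=
  ∏ m ∈ (Finset.range γ).erase j, (s - tk + (m : ℝ) * τ) / (((m : ℝ) - (j : ℝ)) * τ)

theorem continuous_lagC (γ j : ℕ) (tk τ : ℝ) : Continuous (lagC γ j tk τ) := by
  unfold lagC
  fun_prop

theorem lagC_four_zero_eq {τ : ℝ} (hτ : 0 < τ) (tk x : ℝ) :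
    lagC 4 0 tk τ (tk + x * τ) = (x + 1) * (x + 2) * (x + 3) / 6 := by
  have h : (Finset.range 4).erase 0 = {1, 2, 3} := by decide
  simp only [lagC, h]
  simp
  field_simp
  ring

theorem lagC_four_one_eq {τ : ℝ} (hτ : 0 < τ) (tk x : ℝ) :
    lagC 4 1 tk τ (tk + x * τ) = -x * (x + 2) * (x + 3) / 2 := by
  have h : (Finset.range 4).erase 1 = {0, 2, 3} := by decide
  simp only [lagC, h]
  simp
  field_simp
  ring

theorem lagC_four_two_eq {τ : ℝ} (hτ : 0 < τ) (tk x : ℝ) :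
    lagC 4 2 tk τ (tk + x * τ) = x * (x + 1) * (x + 3) / 2 := by
  have h : (Finset.range 4).erase 2 = {0, 1, 3} := by decide
  simp only [lagC, h]
  simp
  field_simp
  ring

theorem lagC_four_three_eq {τ : ℝ} (hτ : 0 < τ) (tk x : ℝ) :
    lagC 4 3 tk τ (tk + x * τ) = -x * (x + 1) * (x + 2) / 6 := by
  have h : (Finset.range 4).erase 3 = {0, 1, 2} := by decide
  simp only [lagC, h]
  simp
  field_simp
  ring

/-- Every point of the mesh cell `[(a - 1) τ, a τ]` is `a τ + x τ` with `-1 ≤ x ≤ 0`. -/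
theorem exists_eq_add_mul_of_mem_Icc {τ a s : ℝ} (hτ : 0 < τ)
    (hs : s ∈ Set.Icc ((a - 1) * τ) (a * τ)) :
    ∃ x : ℝ, -1 ≤ x ∧ x ≤ 0 ∧ s = a * τ + x * τ := by
  refine ⟨s / τ - a, ?_, ?_, by field_simp; ring⟩
  · have := (le_div_iff₀ hτ).2 hs.1
    linarith
  · have := (div_le_iff₀ hτ).2 hs.2
    linarith

theorem lagC_four_zero_nonneg {τ a s : ℝ} (hτ : 0 < τ)
    (hs : s ∈ Set.Icc ((a - 1) * τ) (a * τ)) : 0 ≤ lagC 4 0 (a * τ) τ s := by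
  obtain ⟨x, h1, h0, rfl⟩ := exists_eq_add_mul_of_mem_Icc hτ hs
  rw [lagC_four_zero_eq hτ]
  have := mul_nonneg (mul_nonneg (by linarith : 0 ≤ x + 1) (by linarith : 0 ≤ x + 2))
    (by linarith : 0 ≤ x + 3)
  linarith

theorem lagC_four_one_nonneg {τ a s : ℝ} (hτ : 0 < τ)
    (hs : s ∈ Set.Icc ((a - 1) * τ) (a * τ)) : 0 ≤ lagC 4 1 (a * τ) τ s := by
  obtain ⟨x, h1, h0, rfl⟩ := exists_eq_add_mul_of_mem_Icc hτ hs
  rw [lagC_four_one_eq hτ]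
  have := mul_nonneg (mul_nonneg (by linarith : 0 ≤ -x) (by linarith : 0 ≤ x + 2))
    (by linarith : 0 ≤ x + 3)
  linarith

theorem lagC_four_two_nonpos {τ a s : ℝ} (hτ : 0 < τ)
    (hs : s ∈ Set.Icc ((a - 1) * τ) (a * τ)) : lagC 4 2 (a * τ) τ s ≤ 0 := by
  obtain ⟨x, h1, h0, rfl⟩ := exists_eq_add_mul_of_mem_Icc hτ hs
  rw [lagC_four_two_eq hτ]
  have := mul_nonneg (mul_nonneg (by linarith : 0 ≤ -x) (by linarith : 0 ≤ x + 1))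
    (by linarith : 0 ≤ x + 3)
  linarith

theorem lagC_four_three_nonneg {τ a s : ℝ} (hτ : 0 < τ)
    (hs : s ∈ Set.Icc ((a - 1) * τ) (a * τ)) : 0 ≤ lagC 4 3 (a * τ) τ s := by
  obtain ⟨x, h1, h0, rfl⟩ := exists_eq_add_mul_of_mem_Icc hτ hs
  rw [lagC_four_three_eq hτ]
  have := mul_nonneg (mul_nonneg (by linarith : 0 ≤ -x) (by linarith : 0 ≤ x + 1))
    (by linarith : 0 ≤ x + 2)
  linarith

/-- On adjacent mesh cells, the integral of the coefficient with index `1` dominates the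
absolute value of the integral of the coefficient with index `2`. -/
theorem integral_lagC_four_one_add_two_nonneg {τ : ℝ} (hτ : 0 < τ) (a : ℝ) :
    0 ≤ (∫ s in ((a - 1) * τ)..(a * τ), lagC 4 1 (a * τ) τ s) +
      ∫ s in (a * τ)..((a + 1) * τ), lagC 4 2 ((a + 1) * τ) τ s := by
  have hshift : ∫ s in (a * τ)..((a + 1) * τ), lagC 4 2 ((a + 1) * τ) τ s =
      ∫ s in ((a - 1) * τ)..(a * τ), lagC 4 2 ((a + 1) * τ) τ (s + τ) := by
    rw [intervalIntegral.integral_comp_add_right]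
    congr 1 <;> ring
  have hcont : Continuous fun s => lagC 4 2 ((a + 1) * τ) τ (s + τ) :=
    (continuous_lagC _ _ _ _).comp (continuous_add_const τ)
  rw [hshift, ← intervalIntegral.integral_add
    ((continuous_lagC _ _ _ _).intervalIntegrable _ _) (hcont.intervalIntegrable _ _)]
  refine intervalIntegral.integral_nonneg (by nlinarith) fun s hs => ?_
  obtain ⟨x, h1, h0, rfl⟩ := exists_eq_add_mul_of_mem_Icc hτ hs
  rw [show a * τ + x * τ + τ = (a + 1) * τ + x * τ by ring, lagC_four_one_eq hτ,
    lagC_four_two_eq hτ]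
  nlinarith

/-- **stability of the order-4 scheme.** On the uniform mesh `t_m = mτ`,
for a nonnegative nonincreasing integrable `g` on `[0, t_n]` and `1 ≤ k`, `k + 3 ≤ n`,
the combined weight `w̃_k^4 = ∑_{j=0}^{3} ∫_{t_{k+j-1}}^{t_{k+j}} c_j^{k+j}(s) g(s) ds`
is nonnegative. -/
theorem stmt8 (n : ℕ) (hn : 4 ≤ n) (τ : ℝ) (hτ : 0 < τ)
    (g : ℝ → ℝ) (hg : IntegrableOn g (Set.Icc 0 ((n : ℝ) * τ)))
    (hg0 : ∀ s ∈ Set.Icc (0 : ℝ) ((n : ℝ) * τ), 0 ≤ g s)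
    (hgmono : AntitoneOn g (Set.Icc (0 : ℝ) ((n : ℝ) * τ)))
    (k : ℕ) (hk1 : 1 ≤ k) (hk2 : k + 3 ≤ n) :
    0 ≤ ∑ j ∈ Finset.range 4,
          ∫ s in ((((k + j : ℕ) : ℝ) - 1) * τ)..(((k + j : ℕ) : ℝ) * τ),
            lagC 4 j (((k + j : ℕ) : ℝ) * τ) τ s * g s := by
  have hcell : ∀ j : ℕ, j < 4 →
      Set.Icc ((((k + j : ℕ) : ℝ) - 1) * τ) (((k + j : ℕ) : ℝ) * τ) ⊆
        Set.Icc (0 : ℝ) ((n : ℝ) * τ) := by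
    intro j hj
    have h1 : (1 : ℝ) ≤ ((k + j : ℕ) : ℝ) := by exact_mod_cast (by omega : 1 ≤ k + j)
    have h2 : ((k + j : ℕ) : ℝ) ≤ n := by exact_mod_cast (by omega : k + j ≤ n)
    exact Set.Icc_subset_Icc (mul_nonneg (by linarith) hτ.le)
      (mul_le_mul_of_nonneg_right h2 hτ.le)
  have hle : ∀ a : ℝ, (a - 1) * τ ≤ a * τ := fun a => by nlinarith
  have hint : ∀ j : ℕ, j < 4 → IntervalIntegrable
      (fun s => lagC 4 j (((k + j : ℕ) : ℝ) * τ) τ s * g s) volume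
      ((((k + j : ℕ) : ℝ) - 1) * τ) (((k + j : ℕ) : ℝ) * τ) := by
    intro j hj
    refine IntervalIntegrable.continuousOn_mul ?_ (continuous_lagC _ _ _ _).continuousOn
    rw [intervalIntegrable_iff_integrableOn_Icc_of_le (hle _)]
    exact hg.mono_set (hcell j hj)
  have hmid : ((k + 1 : ℕ) : ℝ) * τ ∈ Set.Icc (0 : ℝ) ((n : ℝ) * τ) :=
    hcell 1 (by norm_num) (Set.right_mem_Icc.2 (hle _))
  have hk : ((k + 2 : ℕ) : ℝ) - 1 = ((k + 1 : ℕ) : ℝ) := by push_cast; ring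
  have h0 : 0 ≤ ∫ s in ((((k + 0 : ℕ) : ℝ) - 1) * τ)..(((k + 0 : ℕ) : ℝ) * τ),
      lagC 4 0 (((k + 0 : ℕ) : ℝ) * τ) τ s * g s :=
    intervalIntegral.integral_nonneg (hle _) fun s hs =>
      mul_nonneg (lagC_four_zero_nonneg hτ hs) (hg0 s (hcell 0 (by norm_num) hs))
  have h3 : 0 ≤ ∫ s in ((((k + 3 : ℕ) : ℝ) - 1) * τ)..(((k + 3 : ℕ) : ℝ) * τ),
      lagC 4 3 (((k + 3 : ℕ) : ℝ) * τ) τ s * g s :=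
    intervalIntegral.integral_nonneg (hle _) fun s hs =>
      mul_nonneg (lagC_four_three_nonneg hτ hs) (hg0 s (hcell 3 (by norm_num) hs))
  have h1 : (∫ s in ((((k + 1 : ℕ) : ℝ) - 1) * τ)..(((k + 1 : ℕ) : ℝ) * τ),
      lagC 4 1 (((k + 1 : ℕ) : ℝ) * τ) τ s) * g (((k + 1 : ℕ) : ℝ) * τ) ≤
      ∫ s in ((((k + 1 : ℕ) : ℝ) - 1) * τ)..(((k + 1 : ℕ) : ℝ) * τ),
        lagC 4 1 (((k + 1 : ℕ) : ℝ) * τ) τ s * g s := by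
    rw [← intervalIntegral.integral_mul_const]
    refine intervalIntegral.integral_mono_on (hle _)
      (((continuous_lagC _ _ _ _).mul continuous_const).intervalIntegrable _ _)
      (hint 1 (by norm_num)) fun s hs => ?_
    exact mul_le_mul_of_nonneg_left (hgmono (hcell 1 (by norm_num) hs) hmid hs.2)
      (lagC_four_one_nonneg hτ hs)
  have h2 : (∫ s in ((((k + 2 : ℕ) : ℝ) - 1) * τ)..(((k + 2 : ℕ) : ℝ) * τ),
      lagC 4 2 (((k + 2 : ℕ) : ℝ) * τ) τ s) * g (((k + 1 : ℕ) : ℝ) * τ) ≤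
      ∫ s in ((((k + 2 : ℕ) : ℝ) - 1) * τ)..(((k + 2 : ℕ) : ℝ) * τ),
        lagC 4 2 (((k + 2 : ℕ) : ℝ) * τ) τ s * g s := by
    rw [← intervalIntegral.integral_mul_const]
    refine intervalIntegral.integral_mono_on (hle _)
      (((continuous_lagC _ _ _ _).mul continuous_const).intervalIntegrable _ _)
      (hint 2 (by norm_num)) fun s hs => ?_
    exact mul_le_mul_of_nonpos_left
      (hgmono hmid (hcell 2 (by norm_num) hs) (hk ▸ hs.1)) (lagC_four_two_nonpos hτ hs)
  have h12 := mul_nonneg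
    (integral_lagC_four_one_add_two_nonneg hτ ((k + 1 : ℕ) : ℝ)) (hg0 _ hmid)
  rw [show ((k + 1 : ℕ) : ℝ) + 1 = ((k + 2 : ℕ) : ℝ) by push_cast; ring, add_mul] at h12
  rw [hk] at h2
  rw [Finset.sum_range_succ, Finset.sum_range_succ, Finset.sum_range_succ,
    Finset.sum_range_one, hk]
  linarith
end

section
/- For every real u ∈ [−1, 0], one has −1 ≤ u(u + 1)(u + 3)(u + 4)/4 + u(u + 1)(u + 2)(u + 3)/24 ≤ 0. -/
/-- For every `u ∈ [-1, 0]`,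
`-1 ≤ u(u+1)(u+3)(u+4)/4 + u(u+1)(u+2)(u+3)/24 ≤ 0`
(the sum of the order-5 Lagrange coefficients `c₂` and `c₄` in the
normalized variable `u`). -/
theorem stmt11 :
    ∀ u ∈ Set.Icc (-1 : ℝ) 0,
      -1 ≤ u * (u + 1) * (u + 3) * (u + 4) / 4 + u * (u + 1) * (u + 2) * (u + 3) / 24 ∧
      u * (u + 1) * (u + 3) * (u + 4) / 4 + u * (u + 1) * (u + 2) * (u + 3) / 24 ≤ 0 := by
  rintro u ⟨hl, hr⟩
  have hp : 0 ≤ -u * (u + 1) := mul_nonneg (by linarith) (by linarith)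
  have hq : 0 ≤ (u + 3) * (7 * u + 26) := mul_nonneg (by linarith) (by linarith)
  have hq' : 0 ≤ 78 - (u + 3) * (7 * u + 26) := by
    have : 0 ≤ -u * (7 * u + 47) := mul_nonneg (by linarith) (by linarith)
    linarith
  have lower := mul_nonneg hp hq'
  have upper := mul_nonneg hp hq
  constructor
  · linarith [sq_nonneg (2 * u + 1)]
  · linarith
end

section
/- Let α ∈ (0, 1) and let d ∈ {1, 2, 3, 4}, and set γ = d + α. Let n ≥ 1 be an integer, τ > 0 with t_m = mτ and τ ≤ 1, and H ≥ 0. Let f : ℝ → ℝ be d times continuously differentiable with |f^{(d)}(x) − f^{(d)}(y)| ≤ H |x − y|^α for all x, y, and let g : [0, t_n] → ℝ be integrable. With the weights w_j^k = ∫_{t_{k−1}}^{t_k} c_j^k(s) g(s) ds of the order-(d+1) Lagrange scheme, there exists a constant C > 0, depending only on d, α and H, such that | ∫_0^{t_n} f(s) g(s) ds − Σ_{k=1}^{n} Σ_{j=0}^{d} w_j^k f(t_{k−j}) | ≤ C · max(τ^γ, τ^{d+1}) · ∫_0^{t_n} |g(s)| ds. -/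
open Finset MeasureTheory

/-- A function with `α`-Hölder `(p + 1)`-st derivative is approximated near `a` to order `p + 1 + α`
by a polynomial of degree at most `p + 1`, namely its Taylor polynomial. -/
theorem exists_polynomial_abs_sub_eval_le {p : ℕ} {α H : ℝ} (hα : 0 < α) (hH : 0 ≤ H)
    {f : ℝ → ℝ} (hf : ContDiff ℝ (p + 1 : ℕ) f)
    (hol : ∀ x y, |iteratedDeriv (p + 1) f x - iteratedDeriv (p + 1) f y| ≤ H * |x - y| ^ α)
    (a : ℝ) :
    ∃ P : Polynomial ℝ, P.degree < (p + 2 : ℕ) ∧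
      ∀ x, |f x - P.eval x| ≤ H * |x - a| ^ α * |x - a| ^ (p + 1) := by
  refine ⟨∑ i ∈ range (p + 2), Polynomial.C ((i.factorial : ℝ)⁻¹ * iteratedDeriv i f a) *
    (Polynomial.X - Polynomial.C a) ^ i, ?_, fun x => ?_⟩
  · rw [Polynomial.degree_lt_iff_coeff_zero]
    intro m hm
    rw [Polynomial.finsetSum_coeff]
    refine Finset.sum_eq_zero fun i hi => ?_
    rw [Polynomial.coeff_C_mul, Polynomial.coeff_eq_zero_of_natDegree_lt, mul_zero]
    rw [Polynomial.natDegree_pow, Polynomial.natDegree_X_sub_C, mul_one]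
    exact (Finset.mem_range.1 hi).trans_le hm
  · rcases eq_or_ne a x with rfl | hx
    · simp [Polynomial.eval_finsetSum, Finset.sum_range_succ', Real.zero_rpow hα.ne']
    obtain ⟨y, hy, hfy⟩ := taylor_mean_remainder_lagrange_iteratedDeriv hx
      (n := p) (by exact_mod_cast hf.contDiffOn)
    have hyx : |y - a| ≤ |x - a| :=
      Set.abs_sub_left_of_mem_uIcc (Set.uIoo_subset_uIcc_self hy)
    have hT : taylorWithinEval f p (Set.uIcc a x) a x =
        ∑ i ∈ range (p + 1), (i.factorial : ℝ)⁻¹ * iteratedDeriv i f a * (x - a) ^ i := by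
      rw [taylor_within_apply]
      refine Finset.sum_congr rfl fun i hi => ?_
      rw [iteratedDerivWithin_eq_iteratedDeriv (uniqueDiffOn_uIcc hx) _ Set.left_mem_uIcc,
        smul_eq_mul]
      · ring
      · exact hf.contDiffAt.of_le (by exact_mod_cast (Finset.mem_range.1 hi).le)
    have herr : f x - (∑ i ∈ range (p + 2), Polynomial.C ((i.factorial : ℝ)⁻¹ *
        iteratedDeriv i f a) * (Polynomial.X - Polynomial.C a) ^ i).eval x =
        (iteratedDeriv (p + 1) f y - iteratedDeriv (p + 1) f a) * (x - a) ^ (p + 1) *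
          ((p + 1).factorial : ℝ)⁻¹ := by
      simp only [Polynomial.eval_finsetSum, Polynomial.eval_mul, Polynomial.eval_C,
        Polynomial.eval_pow, Polynomial.eval_sub, Polynomial.eval_X]
      rw [Finset.sum_range_succ, ← hT, ← sub_sub, hfy]
      ring
    rw [herr, abs_mul, abs_mul, abs_pow, abs_inv, Nat.abs_cast]
    refine (mul_le_of_le_one_right (by positivity) (inv_le_one_of_one_le₀ ?_)).trans ?_
    · exact_mod_cast Nat.one_le_iff_ne_zero.2 (Nat.factorial_ne_zero _)
    · gcongr
      exact (hol y a).trans (by gcongr)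

theorem lagC_eq_eval_basis {γ j : ℕ} (tk τ s : ℝ) :
    lagC γ j tk τ s =
      (Lagrange.basis (range γ) (fun i : ℕ => tk - i * τ) j).eval s := by
  rw [lagC, Lagrange.basis, Polynomial.eval_prod]
  refine Finset.prod_congr rfl fun m _ => ?_
  simp only [Lagrange.basisDivisor, Polynomial.eval_mul, Polynomial.eval_C, Polynomial.eval_sub,
    Polynomial.eval_X]
  rw [div_eq_inv_mul]
  congr 1 <;> ring

/-- The order-`γ` Lagrange scheme reproduces polynomials of degree less than `γ`. -/
theorem eval_eq_sum_lagC_mul {γ : ℕ} {P : Polynomial ℝ} (hP : P.degree < γ) {τ : ℝ} (hτ : τ ≠ 0)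
    (tk s : ℝ) :
    P.eval s = ∑ j ∈ range γ, lagC γ j tk τ s * P.eval (tk - j * τ) := by
  have hinj : Set.InjOn (fun i : ℕ => tk - i * τ) (range γ) := by
    intro i _ j _ hij
    simpa [hτ] using hij
  conv_lhs => rw [Lagrange.eq_interpolate (f := P) hinj (by simpa using hP), Lagrange.interpolate_apply,
    Polynomial.eval_finsetSum]
  refine Finset.sum_congr rfl fun j _ => ?_
  rw [Polynomial.eval_mul, Polynomial.eval_C, lagC_eq_eval_basis, mul_comm]

theorem abs_lagC_le {γ j : ℕ} {tk τ s : ℝ} (hτ : 0 < τ) (h₁ : tk - τ ≤ s) (h₂ : s ≤ tk) :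
    |lagC γ j tk τ s| ≤ (γ : ℝ) ^ γ := by
  rcases Nat.eq_zero_or_pos γ with rfl | hγ
  · simp [lagC]
  rw [lagC, Finset.abs_prod]
  have hγ' : (1 : ℝ) ≤ γ := by exact_mod_cast hγ
  calc ∏ m ∈ (range γ).erase j, |(s - tk + (m : ℝ) * τ) / (((m : ℝ) - (j : ℝ)) * τ)|
      ≤ ∏ _m ∈ (range γ).erase j, (γ : ℝ) := by
        refine Finset.prod_le_prod (fun _ _ => abs_nonneg _) fun m hm => ?_
        obtain ⟨hmj, hm⟩ := Finset.mem_erase.1 hm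
        have hm' : (m : ℝ) + 1 ≤ γ := by exact_mod_cast Finset.mem_range.1 hm
        have hdiff : (1 : ℝ) ≤ |(m : ℝ) - j| := by
          exact_mod_cast Int.one_le_abs (sub_ne_zero.2 (Nat.cast_injective.ne hmj : (m : ℤ) ≠ j))
        rw [abs_div, abs_mul, abs_of_pos hτ]
        refine div_le_of_le_mul₀ (by positivity) (by positivity) ?_
        have hm0 : 0 ≤ (m : ℝ) * τ := by positivity
        calc |s - tk + m * τ| ≤ γ * τ := abs_le.2 ⟨by nlinarith, by nlinarith⟩
          _ ≤ γ * (|(m : ℝ) - j| * τ) := by gcongr; exact le_mul_of_one_le_left hτ.le hdiff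
    _ ≤ (γ : ℝ) ^ γ := by
        rw [Finset.prod_const]
        exact pow_le_pow_right₀ hγ' ((Finset.card_erase_le).trans_eq (Finset.card_range γ))

/-- Interpolation error of the order-`(p + 2)` Lagrange scheme on the last mesh interval. -/
theorem abs_sub_sum_lagC_le {p : ℕ} {α H : ℝ} (hα : 0 < α) (hH : 0 ≤ H)
    {f : ℝ → ℝ} (hf : ContDiff ℝ (p + 1 : ℕ) f)
    (hol : ∀ x y, |iteratedDeriv (p + 1) f x - iteratedDeriv (p + 1) f y| ≤ H * |x - y| ^ α)
    {tk τ s : ℝ} (hτ : 0 < τ) (h₁ : tk - τ ≤ s) (h₂ : s ≤ tk) :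
    |f s - ∑ j ∈ range (p + 2), lagC (p + 2) j tk τ s * f (tk - j * τ)| ≤
      (1 + ∑ _j ∈ range (p + 2), ((p + 2 : ℕ) : ℝ) ^ (p + 2)) *
        (H * ((p + 1 : ℕ) * τ) ^ α * ((p + 1 : ℕ) * τ) ^ (p + 1)) := by
  obtain ⟨P, hdeg, hP⟩ := exists_polynomial_abs_sub_eval_le hα hH hf hol tk
  set B := H * ((p + 1 : ℕ) * τ) ^ α * ((p + 1 : ℕ) * τ) ^ (p + 1) with hB
  have hbound : ∀ x, |x - tk| ≤ (p + 1 : ℕ) * τ → |f x - P.eval x| ≤ B := fun x hx =>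
    (hP x).trans (by rw [hB]; gcongr)
  have hs : |f s - P.eval s| ≤ B := by
    refine hbound s ?_
    rw [abs_of_nonpos (by linarith)]
    push_cast
    nlinarith [mul_nonneg (Nat.cast_nonneg (α := ℝ) p) hτ.le]
  have hnode : ∀ j ∈ range (p + 2), |f (tk - j * τ) - P.eval (tk - j * τ)| ≤ B := by
    intro j hj
    refine hbound _ ?_
    rw [sub_sub_cancel_left, abs_neg, abs_of_nonneg (by positivity)]
    gcongr
    exact Nat.lt_succ_iff.1 (Finset.mem_range.1 hj)
  have hsplit : f s - ∑ j ∈ range (p + 2), lagC (p + 2) j tk τ s * f (tk - j * τ) =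
      (f s - P.eval s) - ∑ j ∈ range (p + 2),
        lagC (p + 2) j tk τ s * (f (tk - j * τ) - P.eval (tk - j * τ)) := by
    simp only [mul_sub, Finset.sum_sub_distrib]
    rw [← eval_eq_sum_lagC_mul hdeg hτ.ne']
    ring
  rw [hsplit, add_mul, one_mul, Finset.sum_mul]
  refine (abs_sub _ _).trans (add_le_add hs ((Finset.abs_sum_le_sum_abs _ _).trans
    (Finset.sum_le_sum fun j hj => ?_)))
  rw [abs_mul]
  exact mul_le_mul (abs_lagC_le hτ h₁ h₂) (hnode j hj) (abs_nonneg _) (by positivity)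

/-- A uniform bound on the interpolation error bounds the composite quadrature error. -/
theorem abs_integral_sub_quadrature_le {γ n : ℕ} {τ M : ℝ} (hτ : 0 < τ)
    {f g : ℝ → ℝ} (hf : Continuous f) (hg : IntegrableOn g (Set.Icc 0 ((n : ℝ) * τ)))
    (herr : ∀ tk s, tk - τ ≤ s → s ≤ tk →
      |f s - ∑ j ∈ range γ, lagC γ j tk τ s * f (tk - j * τ)| ≤ M) :
    |(∫ s in (0 : ℝ)..((n : ℝ) * τ), f s * g s)
        - ∑ k ∈ Finset.Icc 1 n, ∑ j ∈ Finset.range γ,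
            (∫ s in (((k : ℝ) - 1) * τ)..((k : ℝ) * τ), lagC γ j ((k : ℝ) * τ) τ s * g s)
              * f (((k : ℝ) - (j : ℝ)) * τ)|
      ≤ M * ∫ s in (0 : ℝ)..((n : ℝ) * τ), |g s| := by
  have hgi : ∀ k < n, IntervalIntegrable g volume ((k : ℝ) * τ) (((k + 1 : ℕ) : ℝ) * τ) := by
    intro k hk
    have hle : (k : ℝ) * τ ≤ ((k + 1 : ℕ) : ℝ) * τ := by gcongr; omega
    rw [intervalIntegrable_iff_integrableOn_Icc_of_le hle]
    refine hg.mono_set (Set.Icc_subset_Icc (by positivity) ?_)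
    gcongr
    exact hk
  have hfg := fun k hk => (hgi k hk).continuousOn_mul hf.continuousOn
  have habs := intervalIntegral.sum_integral_adjacent_intervals (a := fun k : ℕ => (k : ℝ) * τ)
    fun k hk => (hgi k hk).abs
  have hfgs := intervalIntegral.sum_integral_adjacent_intervals (a := fun k : ℕ => (k : ℝ) * τ) hfg
  simp only [Nat.cast_zero, zero_mul] at habs hfgs
  rw [← habs, ← hfgs, ← Finset.Ico_add_one_right_eq_Icc, Finset.sum_Ico_eq_sum_range,
    Nat.add_sub_cancel, ← Finset.sum_sub_distrib, Finset.mul_sum]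
  refine (Finset.abs_sum_le_sum_abs _ _).trans (Finset.sum_le_sum fun k hk => ?_)
  rw [Finset.mem_range] at hk
  have hlag : ∀ j ∈ range γ, IntervalIntegrable
      (fun s => lagC γ j (((k + 1 : ℕ) : ℝ) * τ) τ s * g s * f (((k + 1 : ℕ) : ℝ) * τ - j * τ))
      volume ((k : ℝ) * τ) (((k + 1 : ℕ) : ℝ) * τ) := fun j _ =>
    ((hgi k hk).continuousOn_mul (continuous_lagC _ _ _ _).continuousOn).mul_const _
  have hquad : ∑ j ∈ range γ, (∫ s in ((((1 + k : ℕ) : ℝ) - 1) * τ)..(((1 + k : ℕ) : ℝ) * τ),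
        lagC γ j (((1 + k : ℕ) : ℝ) * τ) τ s * g s) * f ((((1 + k : ℕ) : ℝ) - (j : ℝ)) * τ) =
      ∫ s in ((k : ℝ) * τ)..(((k + 1 : ℕ) : ℝ) * τ), ∑ j ∈ range γ,
        lagC γ j (((k + 1 : ℕ) : ℝ) * τ) τ s * g s * f (((k + 1 : ℕ) : ℝ) * τ - j * τ) := by
    rw [intervalIntegral.integral_finsetSum hlag]
    refine Finset.sum_congr rfl fun j _ => ?_
    rw [intervalIntegral.integral_mul_const, add_comm 1 k, sub_mul _ (j : ℝ)]
    simp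
  have hsum := IntervalIntegrable.sum _ hlag
  simp only [Finset.sum_fn] at hsum
  rw [hquad, ← intervalIntegral.integral_sub (hfg k hk) hsum,
    ← intervalIntegral.integral_const_mul, ← Real.norm_eq_abs]
  refine intervalIntegral.norm_integral_le_of_norm_le (by gcongr; omega) (.of_forall fun s hs => ?_)
    ((hgi k hk).abs.const_mul M)
  have hsub : f s * g s - ∑ j ∈ range γ,
        lagC γ j (((k + 1 : ℕ) : ℝ) * τ) τ s * g s * f (((k + 1 : ℕ) : ℝ) * τ - j * τ) =
      (f s - ∑ j ∈ range γ,
        lagC γ j (((k + 1 : ℕ) : ℝ) * τ) τ s * f (((k + 1 : ℕ) : ℝ) * τ - j * τ)) * g s := by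
    rw [sub_mul, Finset.sum_mul]
    congr 1
    exact Finset.sum_congr rfl fun j _ => by ring
  rw [hsub, Real.norm_eq_abs, abs_mul]
  refine mul_le_mul_of_nonneg_right (herr _ s ?_ hs.2) (abs_nonneg _)
  have := hs.1
  push_cast
  linarith

/-- **convergence, fractional order `γ = d + α`.** For `α ∈ (0,1)` and
`d ∈ {1,2,3,4}`, there is a constant `C > 0` depending only on `d`, `α` and `H` such
that for every `n ≥ 1`, `0 < τ ≤ 1`, every `f ∈ C^d` whose `d`-th derivative is
`α`-Hölder with constant `H`, and every integrable `g`, the order-`(d+1)` composite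
quadrature error is at most `C · max(τ^{d+α}, τ^{d+1}) · ∫_0^{t_n} |g|`. -/
theorem stmt15 (α : ℝ) (hα : α ∈ Set.Ioo (0 : ℝ) 1) (d : ℕ) (hd : d ∈ Finset.Icc 1 4)
    (H : ℝ) (hH : 0 ≤ H) :
    ∃ C > (0 : ℝ), ∀ n : ℕ, 1 ≤ n → ∀ τ : ℝ, 0 < τ → τ ≤ 1 →
      ∀ f : ℝ → ℝ, ContDiff ℝ d f →
        (∀ x y : ℝ, |iteratedDeriv d f x - iteratedDeriv d f y| ≤ H * |x - y| ^ α) →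
      ∀ g : ℝ → ℝ, IntegrableOn g (Set.Icc 0 ((n : ℝ) * τ)) →
        |(∫ s in (0 : ℝ)..((n : ℝ) * τ), f s * g s)
          - ∑ k ∈ Finset.Icc 1 n, ∑ j ∈ Finset.range (d + 1),
              (∫ s in (((k : ℝ) - 1) * τ)..((k : ℝ) * τ), lagC (d + 1) j ((k : ℝ) * τ) τ s * g s)
                * f (((k : ℝ) - (j : ℝ)) * τ)|
        ≤ C * max (τ ^ ((d : ℝ) + α)) (τ ^ (d + 1))
            * ∫ s in (0 : ℝ)..((n : ℝ) * τ), |g s| := by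
  obtain ⟨p, rfl⟩ : ∃ p, d = p + 1 := ⟨d - 1, by have := (Finset.mem_Icc.1 hd).1; omega⟩
  set K : ℝ := (1 + ∑ _j ∈ range (p + 2), ((p + 2 : ℕ) : ℝ) ^ (p + 2)) *
    (H * ((p + 1 : ℕ) : ℝ) ^ α * ((p + 1 : ℕ) : ℝ) ^ (p + 1)) with hK
  have hK0 : 0 ≤ K := by positivity
  refine ⟨K + 1, by positivity, fun n _ τ hτ _ f hf hol g hg => ?_⟩
  refine abs_integral_sub_quadrature_le hτ hf.continuous hg fun tk s h₁ h₂ => ?_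
  refine (abs_sub_sum_lagC_le hα.1 hH hf hol hτ h₁ h₂).trans ?_
  calc (1 + ∑ _j ∈ range (p + 2), ((p + 2 : ℕ) : ℝ) ^ (p + 2)) *
        (H * ((p + 1 : ℕ) * τ) ^ α * ((p + 1 : ℕ) * τ) ^ (p + 1))
      = K * τ ^ (((p + 1 : ℕ) : ℝ) + α) := by
        rw [Real.mul_rpow (Nat.cast_nonneg _) hτ.le, mul_pow, Real.rpow_add hτ,
          Real.rpow_natCast, hK]
        ring
    _ ≤ (K + 1) * max (τ ^ (((p + 1 : ℕ) : ℝ) + α)) (τ ^ (p + 1 + 1)) := by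
        gcongr
        · linarith
        · exact le_max_left _ _
end

section
/- Fix an integer n ≥ 1 and for i = 0, …, n − 1 let ℓ_i(u) = ∏_{m=0, m≠i}^{n−1} (u + m)/(m − i) be the Lagrange basis polynomials at the nodes 0, −1, −2, …, −(n−1). Then for every u ∈ [−1, 0]: ℓ_0(u) ≥ 0; and for 1 ≤ i ≤ n − 1, ℓ_i(u) ≥ 0 if i is odd, while ℓ_i(u) ≤ 0 if i is even. -/
open Finset

/-- Up to the sign `(-1) ^ j`, the Lagrange basis polynomial at the node `-(j + 1)` is nonnegative
on `[-1, 0]`. -/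
theorem neg_one_pow_mul_lagrangeBasis_nonneg {n j : ℕ} (hj : j + 1 < n) {u : ℝ}
    (hu : u ∈ Set.Icc (-1 : ℝ) 0) :
    0 ≤ (-1 : ℝ) ^ j *
      ∏ m ∈ (Finset.range n).erase (j + 1), (u + (m : ℝ)) / ((m : ℝ) - ((j + 1 : ℕ) : ℝ)) := by
  obtain ⟨hl, hr⟩ := hu
  have hsplit : (Finset.range n).erase (j + 1) =
      Finset.range (j + 1) ∪ Finset.Ico (j + 2) n := by
    ext m
    simp only [Finset.mem_erase, Finset.mem_range, Finset.mem_union, Finset.mem_Ico]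
    omega
  have hdisj : Disjoint (Finset.range (j + 1)) (Finset.Ico (j + 2) n) := by
    rw [Finset.disjoint_left]
    intro m
    simp only [Finset.mem_range, Finset.mem_Ico]
    omega
  have hmid : 0 ≤ (-1 : ℝ) ^ j * ∏ k ∈ Finset.range j,
      (u + ((k + 1 : ℕ) : ℝ)) / (((k + 1 : ℕ) : ℝ) - ((j + 1 : ℕ) : ℝ)) := by
    have hpow : (-1 : ℝ) ^ j = ∏ _k ∈ Finset.range j, (-1 : ℝ) := by simp
    rw [hpow, ← Finset.prod_mul_distrib]
    refine Finset.prod_nonneg fun k hk => ?_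
    have hkj : (k : ℝ) < j := Nat.cast_lt.mpr (Finset.mem_range.mp hk)
    have hk0 : (0 : ℝ) ≤ k := Nat.cast_nonneg k
    push_cast
    exact mul_nonneg_of_nonpos_of_nonpos (by norm_num)
      (div_nonpos_of_nonneg_of_nonpos (by linarith) (by linarith))
  have hzero : 0 ≤ (u + ((0 : ℕ) : ℝ)) / (((0 : ℕ) : ℝ) - ((j + 1 : ℕ) : ℝ)) := by
    apply div_nonneg_of_nonpos
    · simpa using hr
    · push_cast
      linarith [(Nat.cast_nonneg j : (0 : ℝ) ≤ j)]
  have hupper : 0 ≤ ∏ m ∈ Finset.Ico (j + 2) n,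
      (u + (m : ℝ)) / ((m : ℝ) - ((j + 1 : ℕ) : ℝ)) := by
    refine Finset.prod_nonneg fun m hm => ?_
    have h : ((j + 2 : ℕ) : ℝ) ≤ m := Nat.cast_le.mpr (Finset.mem_Ico.mp hm).1
    push_cast at h ⊢
    have hj0 : (0 : ℝ) ≤ j := Nat.cast_nonneg j
    exact div_nonneg (by linarith) (by linarith)
  rw [hsplit, Finset.prod_union hdisj, Finset.prod_range_succ', ← mul_assoc, ← mul_assoc]
  exact mul_nonneg (mul_nonneg hmid hzero) hupper

/-- **sign pattern of the Lagrange basis.** For `n ≥ 1` let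
`ℓ_i(u) = ∏_{m=0, m≠i}^{n-1} (u + m)/(m - i)` be the Lagrange basis polynomials at the
nodes `0, -1, …, -(n-1)`. Then for `u ∈ [-1, 0]`: `ℓ_0(u) ≥ 0`, and for `1 ≤ i ≤ n - 1`
one has `ℓ_i(u) ≥ 0` if `i` is odd and `ℓ_i(u) ≤ 0` if `i` is even. -/
theorem stmt17 (n : ℕ) (hn : 1 ≤ n) (u : ℝ) (hu : u ∈ Set.Icc (-1 : ℝ) 0) :
    0 ≤ ∏ m ∈ (Finset.range n).erase 0, (u + (m : ℝ)) / ((m : ℝ) - (0 : ℝ)) ∧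
    ∀ i : ℕ, 1 ≤ i → i ≤ n - 1 →
      (Odd i → 0 ≤ ∏ m ∈ (Finset.range n).erase i, (u + (m : ℝ)) / ((m : ℝ) - (i : ℝ))) ∧
      (Even i → (∏ m ∈ (Finset.range n).erase i, (u + (m : ℝ)) / ((m : ℝ) - (i : ℝ))) ≤ 0) := by
  refine ⟨Finset.prod_nonneg fun m hm => ?_, fun i hi hin => ?_⟩
  · have h : (1 : ℝ) ≤ m :=
      Nat.one_le_cast.mpr (Nat.one_le_iff_ne_zero.mpr (Finset.mem_erase.mp hm).1)
    exact div_nonneg (by linarith [hu.1]) (by linarith)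
  · obtain ⟨j, rfl⟩ := Nat.exists_eq_add_of_le' hi
    have h := neg_one_pow_mul_lagrangeBasis_nonneg (show j + 1 < n by omega) hu
    refine ⟨fun hodd => ?_, fun heven => ?_⟩
    · have hj : Even j := by simpa [parity_simps] using hodd
      rwa [hj.neg_one_pow, one_mul] at h
    · have hj : Odd j := by simpa [parity_simps] using heven
      rw [hj.neg_one_pow] at h
      linarith
end
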